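/- (Determinant identity used in the proof of Theorem 4.1.) The determinant of the 4×4 complex matrix Q equals (E₀² − A)² + 8E₀·(c₄'(c·J₍₄₎) − c₄(c'·J₍₄₎)) + 8E₀·((c×c')·Ĵ) − 4|c×c'|² − 4|c×Ĵ|² − 4|c'×Ĵ|² − 4|J₍₄₎|²(c₄² + c₄'²) − 4((c₄c₁'−c₄'c₁)² + (c₄c₂'−c₄'c₂)² + (c₄c₃'−c₄'c₃)²) − 4((J₍₄₎·c')² + (J₍₄₎·Ĵ)² + (J₍₄₎·c)²) − 8c₄((c×Ĵ)·J₍₄₎) − 8c₄'((c'×Ĵ)·J₍₄₎). (In particular det Q is real; no positivity hypothesis on Q is needed.) -/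

import Mathlib

noncomputable section

open Matrix
open scoped ComplexOrder

/-- Euclidean dot product on ℝ³. -/
def dot3 (u v : Fin 3 → ℝ) : ℝ := u 0 * v 0 + u 1 * v 1 + u 2 * v 2

/-- Cross product on ℝ³. -/
def cross3 (u v : Fin 3 → ℝ) : Fin 3 → ℝ :=
  ![u 1 * v 2 - u 2 * v 1, u 2 * v 0 - u 0 * v 2, u 0 * v 1 - u 1 * v 0]

/-- Euclidean norm on ℝ³. -/
def norm3 (u : Fin 3 → ℝ) : ℝ := Real.sqrt (dot3 u u)

/-- The 4×4 Hermitian matrix Q = [[E, L], [L*, Ê]] from the positive energy theorem. -/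
def Qmat (E₀ c₁ c₂ c₃ c₄ c₁' c₂' c₃' c₄' J₁₂ J₁₃ J₂₃ J₁₄ J₂₄ J₃₄ : ℝ) :
    Matrix (Fin 4) (Fin 4) ℂ :=
  !![((E₀ + c₄ + c₃' - J₃₄ : ℝ) : ℂ),
     (c₁' : ℂ) + Complex.I * (c₂' : ℂ) - (J₁₄ : ℂ) - Complex.I * (J₂₄ : ℂ),
     (c₃ : ℂ) - (c₄' : ℂ) + Complex.I * (J₁₂ : ℂ),
     (c₁ : ℂ) + Complex.I * (c₂ : ℂ) + (J₁₃ : ℂ) + Complex.I * (J₂₃ : ℂ);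
     (c₁' : ℂ) - Complex.I * (c₂' : ℂ) - (J₁₄ : ℂ) + Complex.I * (J₂₄ : ℂ),
     ((E₀ + c₄ - c₃' + J₃₄ : ℝ) : ℂ),
     (c₁ : ℂ) - Complex.I * (c₂ : ℂ) - (J₁₃ : ℂ) + Complex.I * (J₂₃ : ℂ),
     -(c₃ : ℂ) - (c₄' : ℂ) - Complex.I * (J₁₂ : ℂ);
     (c₃ : ℂ) - (c₄' : ℂ) - Complex.I * (J₁₂ : ℂ),
     (c₁ : ℂ) + Complex.I * (c₂ : ℂ) - (J₁₃ : ℂ) - Complex.I * (J₂₃ : ℂ),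
     ((E₀ - c₄ - c₃' - J₃₄ : ℝ) : ℂ),
     -(c₁' : ℂ) - Complex.I * (c₂' : ℂ) - (J₁₄ : ℂ) - Complex.I * (J₂₄ : ℂ);
     (c₁ : ℂ) - Complex.I * (c₂ : ℂ) + (J₁₃ : ℂ) - Complex.I * (J₂₃ : ℂ),
     -(c₃ : ℂ) - (c₄' : ℂ) + Complex.I * (J₁₂ : ℂ),
     -(c₁' : ℂ) + Complex.I * (c₂' : ℂ) - (J₁₄ : ℂ) + Complex.I * (J₂₄ : ℂ),
     ((E₀ - c₄ + c₃' + J₃₄ : ℝ) : ℂ)]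

theorem dot3_self_nonneg (u : Fin 3 → ℝ) : 0 ≤ dot3 u u := by
  unfold dot3
  nlinarith [mul_self_nonneg (u 0), mul_self_nonneg (u 1), mul_self_nonneg (u 2)]

theorem norm3_sq (u : Fin 3 → ℝ) : norm3 u ^ 2 = dot3 u u :=
  Real.sq_sqrt (dot3_self_nonneg u)

theorem det_of_fin_four {R : Type*} [CommRing R] (a b c d e f g h i j k l m n o p : R) :
    (!![a, b, c, d; e, f, g, h; i, j, k, l; m, n, o, p]).det =
      a * (f * (k * p - l * o) - g * (j * p - l * n) + h * (j * o - k * n)) -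
        b * (e * (k * p - l * o) - g * (i * p - l * m) + h * (i * o - k * m)) +
        c * (e * (j * p - l * n) - f * (i * p - l * m) + h * (i * n - j * m)) -
        d * (e * (j * o - k * n) - f * (i * o - k * m) + g * (i * n - j * m)) := by
  simp [Matrix.det_succ_row_zero, Fin.sum_univ_succ, Fin.succAbove]
  ring

theorem stmt8 (E₀ c₁ c₂ c₃ c₄ c₁' c₂' c₃' c₄' J₁₂ J₁₃ J₂₃ J₁₄ J₂₄ J₃₄ : ℝ) :
    (Qmat E₀ c₁ c₂ c₃ c₄ c₁' c₂' c₃' c₄' J₁₂ J₁₃ J₂₃ J₁₄ J₂₄ J₃₄).det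
      = ((((E₀ ^ 2 - (c₄ ^ 2 + c₄' ^ 2 + norm3 ![c₁, c₂, c₃] ^ 2 + norm3 ![c₁', c₂', c₃'] ^ 2 + norm3 ![J₂₃, -J₁₃, J₁₂] ^ 2 + norm3 ![J₁₄, J₂₄, J₃₄] ^ 2)) ^ 2 + 8 * E₀ * (c₄' * dot3 ![c₁, c₂, c₃] ![J₁₄, J₂₄, J₃₄] - c₄ * dot3 ![c₁', c₂', c₃'] ![J₁₄, J₂₄, J₃₄]) + 8 * E₀ * dot3 (cross3 ![c₁, c₂, c₃] ![c₁', c₂', c₃']) ![J₂₃, -J₁₃, J₁₂] - 4 * norm3 (cross3 ![c₁, c₂, c₃] ![c₁', c₂', c₃']) ^ 2 - 4 * norm3 (cross3 ![c₁, c₂, c₃] ![J₂₃, -J₁₃, J₁₂]) ^ 2 - 4 * norm3 (cross3 ![c₁', c₂', c₃'] ![J₂₃, -J₁₃, J₁₂]) ^ 2 - 4 * norm3 ![J₁₄, J₂₄, J₃₄] ^ 2 * (c₄ ^ 2 + c₄' ^ 2) - 4 * ((c₄ * c₁' - c₄' * c₁) ^ 2 + (c₄ * c₂' - c₄' * c₂)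 ^ 2 + (c₄ * c₃' - c₄' * c₃) ^ 2) - 4 * (dot3 ![J₁₄, J₂₄, J₃₄] ![c₁', c₂', c₃'] ^ 2 + dot3 ![J₁₄, J₂₄, J₃₄] ![J₂₃, -J₁₃, J₁₂] ^ 2 + dot3 ![J₁₄, J₂₄, J₃₄] ![c₁, c₂, c₃] ^ 2) - 8 * c₄ * dot3 (cross3 ![c₁, c₂, c₃] ![J₂₃, -J₁₃, J₁₂]) ![J₁₄, J₂₄, J₃₄] - 8 * c₄' * dot3 (cross3 ![c₁', c₂', c₃'] ![J₂₃, -J₁₃, J₁₂]) ![J₁₄, J₂₄, J₃₄]) : ℝ) : ℂ) := by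
  simp only [norm3_sq, dot3, cross3, Qmat, det_of_fin_four, Matrix.cons_val_zero,
    Matrix.cons_val_one, Matrix.cons_val]
  apply Complex.ext
  all_goals
    simp only [Complex.add_re, Complex.add_im, Complex.sub_re, Complex.sub_im, Complex.neg_re,
      Complex.neg_im, Complex.mul_re, Complex.mul_im, Complex.ofReal_re, Complex.ofReal_im,
      Complex.I_re, Complex.I_im]
    ring
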